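/- Let G be a finite group, π a set of primes, N a normal Hall π-subgroup of G, and H a π-complement of G; assume H is abelian and C_H(N) < H. Then all elements of G \ N·C_H(N) have the same conjugacy class size if and only if C_N(h) = C_N(H) for all h ∈ H \ C_H(N) and C_N(H) is abelian. -/

import Mathlib

open scoped Classical

noncomputable section

/-- `g` is a vanishing element of `G`: some irreducible complex character of `G`
takes the value `0` at `g`. -/
def IsVanishing (G : Type) [Group G] (g : G) : Prop :=
  ∃ V : FDRep ℂ G, CategoryTheory.Simple V ∧ V.character g = 0

/-- The conjugacy class size of `g`, i.e. `|G : C_G(g)|`. -/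
def classSize {G : Type*} [Group G] (g : G) : ℕ := (Subgroup.centralizer {g}).index

/-- The set of conjugacy class sizes of vanishing elements of `G`. -/
def vcs (G : Type) [Group G] : Set ℕ :=
  {n | ∃ g : G, IsVanishing G g ∧ classSize g = n}

/-- The set of conjugacy class sizes of `G`. -/
def cs (G : Type*) [Group G] : Set ℕ := {n | ∃ g : G, classSize g = n}

/-- `H` is a Hall `π`-subgroup of `G`. -/
def IsHallSubgroup {G : Type*} [Group G] (π : Set ℕ) (H : Subgroup G) : Prop :=
  (∀ p : ℕ, p.Prime → p ∣ Nat.card H → p ∈ π) ∧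
  (∀ p : ℕ, p.Prime → p ∣ H.index → p ∉ π)

/-- The set of prime divisors of `n`. -/
def primesOf (n : ℕ) : Set ℕ := {p | p.Prime ∧ p ∣ n}

/-- The `π`-part `n_π` of `n`: the largest divisor of `n` all of whose prime
factors lie in `π`. -/
noncomputable def piPart (π : Set ℕ) (n : ℕ) : ℕ :=
  ∏ p ∈ n.primeFactors, p ^ (if p ∈ π then n.factorization p else 0)

/-- The subgroup `H` is abelian. -/
def IsAbelianSubgroup {G : Type*} [Group G] (H : Subgroup G) : Prop :=
  ∀ a ∈ H, ∀ b ∈ H, a * b = b * a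

/-- `X` is a Frobenius group with kernel `K`: `K` is a nontrivial proper normal
subgroup and the centralizer of every nontrivial element of `K` lies in `K`. -/
def IsFrobeniusWithKernel {X : Type*} [Group X] (K : Subgroup X) : Prop :=
  K ≠ ⊥ ∧ K ≠ ⊤ ∧ K.Normal ∧ ∀ k ∈ K, k ≠ 1 → Subgroup.centralizer {k} ≤ K

/-- `X` is a Frobenius group with kernel `K` and complement `C`. -/
def IsFrobenius {X : Type*} [Group X] (K C : Subgroup X) : Prop :=
  IsFrobeniusWithKernel K ∧ K ⊔ C = ⊤ ∧ K ⊓ C = ⊥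

/-- `G` is supersolvable: there is a chain of subgroups from `⊥` to `⊤`, each
normal in `G`, with all successive quotients cyclic (equivalently, each term is
generated by the previous one together with a single element). -/
def IsSupersolvable (G : Type*) [Group G] : Prop :=
  ∃ (n : ℕ) (c : Fin (n + 1) → Subgroup G),
    c 0 = ⊥ ∧ c (Fin.last n) = ⊤ ∧
    (∀ i : Fin n, c i.castSucc ≤ c i.succ) ∧
    (∀ i : Fin (n + 1), (c i).Normal) ∧
    (∀ i : Fin n, ∃ g : G, c i.castSucc ⊔ Subgroup.zpowers g = c i.succ)

/-- The Fitting subgroup of `G`: the subgroup generated by all nilpotent normal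
subgroups of `G`. -/
def Fitting (G : Type*) [Group G] : Subgroup G :=
  ⨆ H ∈ {H : Subgroup G | H.Normal ∧ Group.IsNilpotent ↥H}, H

/-- `O_p(G)`: the subgroup generated by all normal `p`-subgroups of `G`
(the largest normal `p`-subgroup). -/
def pCore' (p : ℕ) (G : Type*) [Group G] : Subgroup G :=
  ⨆ K ∈ {K : Subgroup G | K.Normal ∧ IsPGroup p ↥K}, K


lemma IsHallSubgroup.coprime_card_compl {G : Type*} [Group G] {π : Set ℕ} {N H : Subgroup G}
    (hN : IsHallSubgroup π N) (hH : IsHallSubgroup πᶜ H) :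
    (Nat.card N).Coprime (Nat.card H) :=
  Nat.Coprime.symm <| Nat.coprime_of_dvd fun p hp hpH hpN => hH.1 p hp hpH (hN.1 p hp hpN)

lemma IsHallSubgroup.sup_compl_eq_top {G : Type*} [Group G] {π : Set ℕ} {N H : Subgroup G}
    (hN : IsHallSubgroup π N) (hH : IsHallSubgroup πᶜ H) : N ⊔ H = ⊤ := by
  rw [← Subgroup.index_eq_one]
  by_contra hne
  obtain ⟨p, hp, hpd⟩ := Nat.exists_prime_and_dvd hne
  have hpN := hN.2 p hp (hpd.trans (Subgroup.index_dvd_of_le le_sup_left))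
  exact hH.2 p hp (hpd.trans (Subgroup.index_dvd_of_le le_sup_right)) hpN

/-- For subgroups of coprime order, a single exponent extracts the second factor of every
product of commuting elements. -/
lemma exists_pow_mul_eq_right {G : Type*} [Group G] {N H : Subgroup G}
    (hcop : (Nat.card N).Coprime (Nat.card H)) :
    ∃ k : ℕ, ∀ n ∈ N, ∀ h ∈ H, Commute n h → (n * h) ^ k = h := by
  obtain ⟨k, hkN, hkH⟩ := Nat.chineseRemainder hcop 0 1
  refine ⟨k, fun n hn h hh hc => ?_⟩
  have hn1 : n ^ k = 1 := orderOf_dvd_iff_pow_eq_one.mp <|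
    (Subgroup.orderOf_dvd_natCard N hn).trans ((Nat.modEq_zero_iff_dvd).mp hkN)
  have hh1 : h ^ k = h ^ 1 := pow_eq_pow_iff_modEq.mpr <|
    hkH.of_dvd (Subgroup.orderOf_dvd_natCard H hh)
  rw [hc.mul_pow, hn1, hh1, one_mul, pow_one]

/-- For subgroups of coprime order, an element commuting with a product of commuting elements
commutes with the second factor. -/
lemma commute_right_of_commute_mul {G : Type*} [Group G] {N H : Subgroup G}
    (hcop : (Nat.card N).Coprime (Nat.card H)) {n h x : G} (hn : n ∈ N) (hh : h ∈ H)
    (hc : Commute n h) (hx : Commute (n * h) x) : Commute h x := by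
  obtain ⟨k, hk⟩ := exists_pow_mul_eq_right hcop
  have := hx.pow_left k
  rwa [hk n hn h hh hc] at this

/-- The class size is invariant under conjugation. -/
lemma classSize_conj {G : Type*} [Group G] (x g : G) :
    classSize (x * g * x⁻¹) = classSize g := by
  have : Subgroup.centralizer {x * g * x⁻¹} =
      (Subgroup.centralizer {g}).map (MulAut.conj x).toMonoidHom := by
    ext y
    rw [Subgroup.mem_map_equiv, Subgroup.mem_centralizer_singleton_iff,
      Subgroup.mem_centralizer_singleton_iff, ← (MulAut.conj x⁻¹).injective.eq_iff]
    simp [MulAut.conj_symm_apply, mul_assoc]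
  rw [classSize, this]
  exact Subgroup.index_map_equiv _ (MulAut.conj x)

lemma mul_mem_sup_iff_of_disjoint {G : Type*} [Group G] {N H Z : Subgroup G} [N.Normal]
    (hdis : Disjoint N H) (hZ : Z ≤ H) {n h : G} (hn : n ∈ N) (hh : h ∈ H) :
    n * h ∈ N ⊔ Z ↔ h ∈ Z := by
  refine ⟨fun hmem => ?_, fun hz => Subgroup.mul_mem_sup hn hz⟩
  obtain ⟨m, hm, z, hz, e⟩ := Subgroup.mem_sup_of_normal_left.mp hmem
  have e' : m⁻¹ * n = z * h⁻¹ := by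
    rw [eq_mul_inv_iff_mul_eq, mul_assoc, ← e, inv_mul_cancel_left]
  have h1 : z * h⁻¹ = 1 := Subgroup.disjoint_def.mp hdis
    (e' ▸ N.mul_mem (N.inv_mem hm) hn) (H.mul_mem (hZ hz) (H.inv_mem hh))
  rwa [mul_inv_eq_one.mp h1] at hz

/-- If `N` is a normal subgroup of order coprime to that of `H` and `h ∈ H`, every element of
the coset `Nh` is `N`-conjugate to an element of `C_N(h)h`. -/
lemma exists_conj_centralizer_mul {G : Type*} [Group G] [Finite G] {N H : Subgroup G}
    (hN : N.Normal) (hcop : (Nat.card N).Coprime (Nat.card H)) {n h : G} (hn : n ∈ N)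
    (hh : h ∈ H) :
    ∃ x : G, ∃ a ∈ Subgroup.centralizer {h} ⊓ N, x * (a * h) * x⁻¹ = n * h := by
  set A : Subgroup N := (Subgroup.centralizer {h}).subgroupOf N
  have hcomm (a : A) : Commute ((a : N) : G) h :=
    Subgroup.mem_centralizer_singleton_iff.mp (Subgroup.mem_subgroupOf.mp a.2)
  let f : (N ⧸ A) × A → N := fun p =>
    ⟨(p.1.out : G) * ((p.2 : N) * h) * (p.1.out : G)⁻¹ * h⁻¹, by
      have h1 := hN.conj_mem _ (N.inv_mem p.1.out.2) h
      have h2 := N.mul_mem (N.mul_mem p.1.out.2 (p.2 : N).2) h1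
      convert h2 using 1
      group⟩
  have hf : Function.Injective f := by
    rintro ⟨q, a⟩ ⟨r, b⟩ he
    have he' : (q.out : G) * ((a : N) * h) * (q.out : G)⁻¹ =
        (r.out : G) * ((b : N) * h) * (r.out : G)⁻¹ :=
      mul_right_cancel (congrArg Subtype.val he)
    obtain ⟨k, hk⟩ := exists_pow_mul_eq_right hcop
    have hpow := congrArg (· ^ k) he'
    simp only [conj_pow, hk _ (a : N).2 h hh (hcomm a), hk _ (b : N).2 h hh (hcomm b)] at hpow
    have hqr : q = r := by
      rw [← q.out_eq', ← r.out_eq', QuotientGroup.eq]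
      refine Subgroup.mem_subgroupOf.mpr (Subgroup.mem_centralizer_singleton_iff.mpr ?_)
      push_cast
      calc (q.out : G)⁻¹ * r.out * h = (q.out : G)⁻¹ * (r.out * h * (r.out : G)⁻¹) * r.out := by
            group
        _ = h * ((q.out : G)⁻¹ * r.out) := by
            rw [← hpow]
            group
    subst hqr
    have := mul_right_cancel (mul_left_cancel (mul_right_cancel he'))
    exact Prod.ext rfl (Subtype.ext (Subtype.ext this))
  have hbij := hf.bijective_of_nat_card_le
    (by rw [Nat.card_prod, ← Subgroup.card_eq_card_quotient_mul_card_subgroup])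
  obtain ⟨⟨q, a⟩, hqa⟩ := hbij.2 ⟨n, hn⟩
  refine ⟨q.out, (a : N), ⟨Subgroup.mem_subgroupOf.mp a.2, (a : N).2⟩, ?_⟩
  exact mul_inv_eq_iff_eq_mul.mp (congrArg Subtype.val hqa)

/-- Corollary 2.5(a): with `H` abelian and `C_H(N) < H`, all elements of
`G \ N·C_H(N)` have the same class size iff `C_N(h) = C_N(H)` for all
`h ∈ H \ C_H(N)` and `C_N(H)` is abelian. -/
theorem statement8 (G : Type) [Group G] [Finite G] (π : Set ℕ)
    (N H : Subgroup G) (hN : N.Normal) (hNhall : IsHallSubgroup π N)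
    (hHhall : IsHallSubgroup πᶜ H) (hab : IsAbelianSubgroup H)
    (hlt : Subgroup.centralizer (N : Set G) ⊓ H < H) :
    ((∀ g₁ : G, g₁ ∉ N ⊔ (Subgroup.centralizer (N : Set G) ⊓ H) →
        ∀ g₂ : G, g₂ ∉ N ⊔ (Subgroup.centralizer (N : Set G) ⊓ H) →
          classSize g₁ = classSize g₂) ↔
      ((∀ h ∈ H, h ∉ Subgroup.centralizer (N : Set G) →
          Subgroup.centralizer {h} ⊓ N = Subgroup.centralizer (H : Set G) ⊓ N) ∧
       IsAbelianSubgroup (Subgroup.centralizer (H : Set G) ⊓ N))) := by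
  have hcop := hNhall.coprime_card_compl hHhall
  have htop := hNhall.sup_compl_eq_top hHhall
  have hdis : Disjoint N H := Subgroup.disjoint_of_coprime_natCard hcop
  have hmem {n h : G} (hn : n ∈ N) (hh : h ∈ H) :
      n * h ∈ N ⊔ (Subgroup.centralizer (N : Set G) ⊓ H) ↔
        h ∈ Subgroup.centralizer (N : Set G) := by
    rw [mul_mem_sup_iff_of_disjoint hdis inf_le_right hn hh]
    exact ⟨fun hz => hz.1, fun hz => ⟨hz, hh⟩⟩
  have hdecomp (g : G) : ∃ n ∈ N, ∃ h ∈ H, n * h = g :=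
    Subgroup.mem_sup_of_normal_left.mp (htop ▸ Subgroup.mem_top g)
  constructor
  · intro hsize
    have hcentral {h n x : G} (hh : h ∈ H) (hhN : h ∉ Subgroup.centralizer (N : Set G))
        (hn : n ∈ N) (hnh : Commute n h) (hx : Commute x h) : Commute x n := by
      have hle : Subgroup.centralizer {n * h} ≤ Subgroup.centralizer {h} := fun y hy => by
        rw [Subgroup.mem_centralizer_singleton_iff] at hy ⊢
        exact (commute_right_of_commute_mul hcop hn hh hnh (Commute.symm hy)).symm
      have hindex : (Subgroup.centralizer {n * h}).index = (Subgroup.centralizer {h}).index :=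
        hsize _ (by rwa [hmem hn hh]) _ (by rw [← one_mul h]; rwa [hmem N.one_mem hh])
      have hcard : Nat.card (Subgroup.centralizer {n * h}) =
          Nat.card (Subgroup.centralizer {h}) := by
        have h1 := (Subgroup.centralizer {n * h}).card_mul_index
        rw [hindex, ← (Subgroup.centralizer {h}).card_mul_index] at h1
        exact Nat.eq_of_mul_eq_mul_right
          (Nat.pos_of_ne_zero Subgroup.index_ne_zero_of_finite) h1
      have heq := Subgroup.eq_of_le_of_card_ge hle hcard.ge
      have hxm : x ∈ Subgroup.centralizer {n * h} := by
        rw [heq]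
        exact Subgroup.mem_centralizer_singleton_iff.mpr hx
      have hxnh : Commute x (n * h) := Subgroup.mem_centralizer_singleton_iff.mp hxm
      simpa using hxnh.mul_right hx.inv_right
    refine ⟨fun h hh hhN => le_antisymm ?_ ?_, ?_⟩
    · rintro n ⟨hnh, hn⟩
      refine ⟨Subgroup.mem_centralizer_iff.mpr fun x hx => ?_, hn⟩
      exact hcentral hh hhN hn (Subgroup.mem_centralizer_singleton_iff.mp hnh) (hab x hx h hh)
    · exact inf_le_inf_right _ (Subgroup.centralizer_le (by simpa using hh))
    · obtain ⟨h, hh, hhZ⟩ := SetLike.exists_of_lt hlt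
      rintro a ⟨haH, -⟩ b ⟨hbH, hbN⟩
      exact hcentral hh (fun hz => hhZ ⟨hz, hh⟩) hbN
        (Subgroup.mem_centralizer_iff.mp hbH h hh).symm
        (Subgroup.mem_centralizer_iff.mp haH h hh).symm
  · rintro ⟨hcent, habel⟩
    suffices hall : ∀ g : G, g ∉ N ⊔ (Subgroup.centralizer (N : Set G) ⊓ H) →
        classSize g = ((Subgroup.centralizer (H : Set G) ⊓ N) ⊔ H).index from
      fun g₁ hg₁ g₂ hg₂ => (hall g₁ hg₁).trans (hall g₂ hg₂).symm
    intro g hg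
    obtain ⟨n, hn, h, hh, rfl⟩ := hdecomp g
    rw [hmem hn hh] at hg
    obtain ⟨x, a, ha, hxa⟩ := exists_conj_centralizer_mul hN hcop hn hh
    rw [← hxa, classSize_conj, classSize]
    have hah : Commute a h := Subgroup.mem_centralizer_singleton_iff.mp ha.1
    congr 1
    apply le_antisymm
    · intro y hy
      have hyc : Commute y (a * h) := Subgroup.mem_centralizer_singleton_iff.mp hy
      have hyh := (commute_right_of_commute_mul hcop ha.2 hh hah hyc.symm).symm
      obtain ⟨m, hm, k, hk, rfl⟩ := hdecomp y
      have hkh : Commute k h := hab k hk h hh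
      have hmh : Commute m h := by simpa using hyh.mul_left hkh.inv_left
      refine Subgroup.mul_mem_sup ?_ hk
      rw [← hcent h hh hg]
      exact ⟨Subgroup.mem_centralizer_singleton_iff.mpr hmh, hm⟩
    · rw [hcent h hh hg] at ha
      have haH {y : G} (hy : y ∈ H) : Commute y a := Subgroup.mem_centralizer_iff.mp ha.1 y hy
      refine sup_le (fun y hy => ?_) (fun y hy => ?_) <;>
        refine Subgroup.mem_centralizer_singleton_iff.mpr (Commute.mul_right ?_ ?_)
      · exact habel y hy a ha
      · exact (Subgroup.mem_centralizer_iff.mp hy.1 h hh).symm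
      · exact haH hy
      · exact hab y hy h hh
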